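/- arXiv:1303.0815 — 2 statements merged into one kernel-verified Lean document; each statement's English description precedes it below -/
import Mathlib

section
/- Let F be a filter on a set I and let (X_j)_{j∈J} be a family of nonempty topological spaces. Then the product space ∏_{j∈J} X_j is F-compact if and only if every factor X_j is F-compact. -/
universe u v w

/-- A sequence `x : I → X` `F`-converges to `p` if for every open neighborhood `U` of `p`,
the set `{i | x i ∈ U}` belongs to `F`. -/
def FLimit {I : Type u} {X : Type v} [TopologicalSpace X] (F : Filter I)
    (x : I → X) (p : X) : Prop :=
  ∀ U : Set X, IsOpen U → p ∈ U → {i | x i ∈ U} ∈ F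

/-- A space `X` is `F`-compact if every `I`-indexed sequence in `X` `F`-converges
to some point of `X`. -/
def FCompact {I : Type u} (F : Filter I) (X : Type v) [TopologicalSpace X] : Prop :=
  ∀ x : I → X, ∃ p : X, FLimit F x p

theorem fLimit_iff_tendsto {I : Type u} {X : Type v} [TopologicalSpace X] {F : Filter I}
    {x : I → X} {p : X} : FLimit F x p ↔ Filter.Tendsto x F (nhds p) := by
  rw [tendsto_nhds]
  rfl

theorem FCompact.of_surjective {I : Type u} {X : Type v} {Y : Type w} [TopologicalSpace X]
    [TopologicalSpace Y] {F : Filter I} (hX : FCompact F X) {f : X → Y} (hf : Continuous f)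
    (hsurj : Function.Surjective f) : FCompact F Y := by
  intro y
  choose g hg using hsurj
  obtain ⟨p, hp⟩ := hX (g ∘ y)
  refine ⟨f p, fLimit_iff_tendsto.2 ?_⟩
  simpa [Function.comp_def, hg] using (hf.tendsto p).comp (fLimit_iff_tendsto.1 hp)

theorem FCompact.pi {I : Type u} {J : Type v} {F : Filter I} {X : J → Type w}
    [∀ j, TopologicalSpace (X j)] (h : ∀ j, FCompact F (X j)) : FCompact F (Π j, X j) := by
  intro x
  choose p hp using fun j => h j fun i => x i j
  exact ⟨p, fLimit_iff_tendsto.2 (tendsto_pi_nhds.2 fun j => fLimit_iff_tendsto.1 (hp j))⟩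

/-- A product of nonempty topological spaces is `F`-compact iff every factor is
`F`-compact. -/
theorem fCompact_pi_iff {I : Type u} {J : Type v} (F : Filter I)
    (X : J → Type w) [∀ j, TopologicalSpace (X j)] [∀ j, Nonempty (X j)] :
    FCompact F (Π j, X j) ↔ ∀ j, FCompact F (X j) :=
  ⟨fun h j => h.of_surjective (continuous_apply j) (Function.surjective_eval j), FCompact.pi⟩
end

section
/- Assume 𝔥 = 𝔰, and let X = ∏_{j∈J} X_j be a product of nonempty topological spaces. Then the following are equivalent: (1) X is sequentially compact; (2) every factor X_j is sequentially compact and the set of indices j ∈ J such that X_j contains a sequence converging to no point of X_j has cardinality strictly less than 𝔰; (3) every factor X_j is sequentially compact and the set of indices j ∈ J such that X_j is not ultraconnected has cardinality strictly less than 𝔰. -/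
universe u

/-- The splitting number `𝔰`: the least cardinality of a family `S` of infinite subsets
of `ℕ` such that every infinite `A ⊆ ℕ` is split by some member of `S`. -/
noncomputable def splittingNumber : Cardinal.{0} :=
  sInf {c : Cardinal.{0} | ∃ S : Set (Set ℕ), Cardinal.mk S = c ∧
    (∀ s ∈ S, s.Infinite) ∧
    ∀ A : Set ℕ, A.Infinite → ∃ s ∈ S, (A ∩ s).Infinite ∧ (A \ s).Infinite}

/-- The cardinal `𝔥`: the smallest cardinality of a family of sequentially compact
nonempty topological spaces whose product is not sequentially compact. -/
noncomputable def hCardinal : Cardinal.{0} :=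
  sInf {c : Cardinal.{0} | ∃ (J : Type) (X : J → Type)
    (_ : ∀ j, TopologicalSpace (X j)), Cardinal.mk J = c ∧
    (∀ j, Nonempty (X j)) ∧ (∀ j, SeqCompactSpace (X j)) ∧
    ¬ SeqCompactSpace (Π j, X j)}

/-- A topological space is ultraconnected if no two nonempty closed sets are disjoint. -/
def Ultraconnected (X : Type u) [TopologicalSpace X] : Prop :=
  ∀ C D : Set X, IsClosed C → IsClosed D → C.Nonempty → D.Nonempty → (C ∩ D).Nonempty

open Filter Topology

theorem exists_splitting_family_mk_eq :
    ∃ S : Set (Set ℕ), Cardinal.mk S = splittingNumber ∧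
      (∀ s ∈ S, s.Infinite) ∧
      ∀ A : Set ℕ, A.Infinite → ∃ s ∈ S, (A ∩ s).Infinite ∧ (A \ s).Infinite := by
  refine csInf_mem (s := {c : Cardinal.{0} | ∃ S : Set (Set ℕ), Cardinal.mk S = c ∧
    (∀ s ∈ S, s.Infinite) ∧
    ∀ A : Set ℕ, A.Infinite → ∃ s ∈ S, (A ∩ s).Infinite ∧ (A \ s).Infinite})
    ⟨_, {s | s.Infinite}, rfl, fun s hs => hs, fun A hA => ?_⟩
  have hf : StrictMono (Nat.nth (· ∈ A)) := Nat.nth_strictMono hA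
  have hmem (n : ℕ) : Nat.nth (· ∈ A) n ∈ A := Nat.nth_mem_of_infinite hA n
  set f := Nat.nth (· ∈ A)
  have heven : (Set.range fun n => f (2 * n)).Infinite :=
    Set.infinite_range_of_injective fun a b h => by
      have := hf.injective h
      omega
  have hodd : (Set.range fun n => f (2 * n + 1)).Infinite :=
    Set.infinite_range_of_injective fun a b h => by
      have := hf.injective h
      omega
  refine ⟨_, heven, heven.mono ?_, hodd.mono ?_⟩
  · rintro _ ⟨n, rfl⟩
    exact ⟨hmem _, n, rfl⟩
  · rintro _ ⟨n, rfl⟩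
    refine ⟨hmem _, ?_⟩
    rintro ⟨m, hm⟩
    have := hf.injective hm
    omega

theorem SeqCompactSpace.exists_subseq_tendsto {X : Type*} [TopologicalSpace X]
    [SeqCompactSpace X] (u : ℕ → X) :
    ∃ a, ∃ φ : ℕ → ℕ, StrictMono φ ∧ Tendsto (u ∘ φ) atTop (𝓝 a) :=
  SeqCompactSpace.tendsto_subseq u

theorem seqCompactSpace_of_forall_exists {X : Type*} [TopologicalSpace X]
    (h : ∀ u : ℕ → X, ∃ a, ∃ φ : ℕ → ℕ, StrictMono φ ∧ Tendsto (u ∘ φ) atTop (𝓝 a)) :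
    SeqCompactSpace X :=
  ⟨fun u _ => let ⟨a, φ, hφ, ha⟩ := h u; ⟨a, trivial, φ, hφ, ha⟩⟩

/-- Formal terms generated by a sequence under the operation of taking a limit of a
subsequence. -/
inductive SeqTerm : Type
  | leaf (n : ℕ) : SeqTerm
  | node (w : ℕ → SeqTerm) : SeqTerm

/-- Evaluation of formal terms in a sequentially compact space. -/
noncomputable def SeqTerm.eval {X : Type*} [TopologicalSpace X] [SeqCompactSpace X]
    (u : ℕ → X) : SeqTerm → X
  | leaf n => u n
  | node w => (SeqCompactSpace.exists_subseq_tendsto fun n => (w n).eval u).choose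

/-- Formal terms with the topology induced by evaluation at `u`. -/
structure SeqTermAt {X : Type*} (u : ℕ → X) : Type where
  /-- The underlying formal term. -/
  term : SeqTerm

noncomputable instance {X : Type*} [TopologicalSpace X] [SeqCompactSpace X] (u : ℕ → X) :
    TopologicalSpace (SeqTermAt u) :=
  .induced (fun w => w.term.eval u) inferInstance

theorem SeqTermAt.tendsto_iff {X ι : Type*} [TopologicalSpace X] [SeqCompactSpace X]
    {u : ℕ → X} {l : Filter ι} {w : ι → SeqTermAt u} {a : SeqTermAt u} :
    Tendsto w l (𝓝 a) ↔ Tendsto (fun i => (w i).term.eval u) l (𝓝 (a.term.eval u)) := by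
  rw [nhds_induced, tendsto_comap_iff, Function.comp_def]

instance {X : Type*} [TopologicalSpace X] [SeqCompactSpace X] (u : ℕ → X) :
    SeqCompactSpace (SeqTermAt u) := by
  refine seqCompactSpace_of_forall_exists fun w => ⟨⟨.node fun n => (w n).term⟩, ?_⟩
  obtain ⟨φ, hφ, h⟩ :=
    (SeqCompactSpace.exists_subseq_tendsto fun n => (w n).term.eval u).choose_spec
  exact ⟨φ, hφ, SeqTermAt.tendsto_iff.2 h⟩

theorem seqCompactSpace_pi_of_mk_lt_hCardinal {J : Type*} (X : J → Type*)
    [∀ j, TopologicalSpace (X j)] [∀ j, SeqCompactSpace (X j)]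
    (hJ : Cardinal.mk J < Cardinal.lift hCardinal) : SeqCompactSpace (Π j, X j) := by
  obtain ⟨c, hc⟩ := Cardinal.mem_range_lift_of_le hJ.le
  rw [← hc, Cardinal.lift_lt] at hJ
  obtain ⟨e⟩ : Nonempty (J ≃ c.out) := by
    rw [← Cardinal.lift_mk_eq', ← hc, Cardinal.mk_out, Cardinal.lift_lift, Cardinal.lift_umax]
  refine seqCompactSpace_of_forall_exists fun u => ?_
  have : SeqCompactSpace (Π i, SeqTermAt fun n => u n (e.symm i)) := by
    by_contra hT
    exact notMem_of_lt_csInf hJ (OrderBot.bddBelow _)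
      ⟨c.out, _, inferInstance, c.mk_out, fun _ => ⟨⟨.leaf 0⟩⟩, inferInstance, hT⟩
  obtain ⟨a, φ, hφ, ha⟩ := SeqCompactSpace.exists_subseq_tendsto
    (X := Π i, SeqTermAt fun n => u n (e.symm i)) fun n _ => ⟨.leaf n⟩
  have hlim (j : J) : ∃ p, Tendsto (fun n => u (φ n) j) atTop (𝓝 p) := by
    obtain ⟨i, rfl⟩ := e.symm.surjective j
    exact ⟨_, SeqTermAt.tendsto_iff.1 (tendsto_pi_nhds.1 ha i)⟩
  choose b hb using hlim
  exact ⟨b, φ, hφ, tendsto_pi_nhds.2 hb⟩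

theorem SeqCompactSpace.of_pi {J : Type*} {X : J → Type*}
    [∀ j, TopologicalSpace (X j)] [∀ j, Nonempty (X j)] [SeqCompactSpace (Π j, X j)] (j : J) :
    SeqCompactSpace (X j) := by
  classical
  refine seqCompactSpace_of_forall_exists fun v => ?_
  obtain ⟨a, φ, hφ, ha⟩ := SeqCompactSpace.exists_subseq_tendsto (X := Π i, X i)
    fun n => Function.update (fun i => Classical.arbitrary (X i)) j (v n)
  exact ⟨a j, φ, hφ, by simpa [Function.comp_def] using tendsto_pi_nhds.1 ha j⟩

theorem Ultraconnected.exists_tendsto {X : Type*} [TopologicalSpace X] [SeqCompactSpace X]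
    (h : Ultraconnected X) (u : ℕ → X) : ∃ p, Tendsto u atTop (𝓝 p) := by
  have hfin (n : ℕ) : IsClosed (⋂ k ≤ n, closure {u k}) ∧
      (⋂ k ≤ n, closure {u k}).Nonempty := by
    refine ⟨isClosed_biInter fun _ _ => isClosed_closure, ?_⟩
    induction n with
    | zero => exact ⟨u 0, by simpa using subset_closure (Set.mem_singleton (u 0))⟩
    | succ n ih =>
      obtain ⟨x, hx, hx'⟩ := h _ _ (isClosed_biInter fun _ _ => isClosed_closure)
        (isClosed_closure (s := {u (n + 1)})) ih ⟨_, subset_closure rfl⟩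
      refine ⟨x, Set.mem_iInter₂.2 fun k hk => ?_⟩
      rcases Nat.le_succ_iff.1 hk with hk | rfl
      · exact Set.mem_iInter₂.1 hx k hk
      · exact hx'
  choose x hx using fun n => (hfin n).2
  obtain ⟨p, φ, hφ, hp⟩ := SeqCompactSpace.exists_subseq_tendsto x
  have hmem (k : ℕ) : p ∈ closure {u k} :=
    isClosed_closure.mem_of_tendsto hp <| (eventually_ge_atTop k).mono fun n hn =>
      Set.mem_iInter₂.1 (hx (φ n)) k (hn.trans (hφ.id_le n))
  refine ⟨p, tendsto_nhds.2 fun s hs hps => Eventually.of_forall fun k => ?_⟩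
  obtain ⟨_, hy, rfl⟩ := mem_closure_iff.1 (hmem k) s hs hps
  exact hy

theorem not_tendsto_of_frequently_mem_disjoint {X : Type*} [TopologicalSpace X] {C D : Set X}
    (hC : IsClosed C) (hD : IsClosed D) (hCD : ¬ (C ∩ D).Nonempty) {u : ℕ → X}
    (huC : ∃ᶠ n in atTop, u n ∈ C) (huD : ∃ᶠ n in atTop, u n ∈ D) (p : X) :
    ¬ Tendsto u atTop (𝓝 p) := fun h =>
  hCD ⟨p, hC.mem_of_frequently_of_tendsto huC h, hD.mem_of_frequently_of_tendsto huD h⟩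

theorem ultraconnected_of_forall_exists_tendsto {X : Type*} [TopologicalSpace X]
    (h : ∀ u : ℕ → X, ∃ p, Tendsto u atTop (𝓝 p)) : Ultraconnected X := by
  intro C D hC hD ⟨x, hx⟩ ⟨y, hy⟩
  by_contra hCD
  obtain ⟨p, hp⟩ := h fun n => if Even n then x else y
  refine not_tendsto_of_frequently_mem_disjoint hC hD hCD ?_ ?_ p hp
  · exact frequently_atTop.2 fun n => ⟨2 * n, by omega, by simpa using hx⟩
  · exact frequently_atTop.2 fun n => ⟨2 * n + 1, by omega, by simpa using hy⟩

theorem ultraconnected_iff_forall_exists_tendsto {X : Type*} [TopologicalSpace X]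
    [SeqCompactSpace X] : Ultraconnected X ↔ ∀ u : ℕ → X, ∃ p, Tendsto u atTop (𝓝 p) :=
  ⟨Ultraconnected.exists_tendsto, ultraconnected_of_forall_exists_tendsto⟩

theorem mk_not_ultraconnected_lt_splittingNumber {J : Type u} (X : J → Type*)
    [∀ j, TopologicalSpace (X j)] [∀ j, Nonempty (X j)] [SeqCompactSpace (Π j, X j)] :
    Cardinal.mk {j : J | ¬ Ultraconnected (X j)} < Cardinal.lift.{u} splittingNumber := by
  classical
  by_contra! hle
  obtain ⟨S, hS, -, hsplit⟩ := exists_splitting_family_mk_eq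
  rw [← hS, ← Cardinal.lift_id'.{0, u} (Cardinal.mk {j : J | ¬ Ultraconnected (X j)})] at hle
  obtain ⟨f⟩ := Cardinal.lift_mk_le'.1 hle
  have hU (j : {j : J | ¬ Ultraconnected (X j)}) : ∃ C D : Set (X j), IsClosed C ∧ IsClosed D ∧
      C.Nonempty ∧ D.Nonempty ∧ ¬ (C ∩ D).Nonempty := by
    simpa [Ultraconnected] using j.2
  choose C D hC hD hx hy hCD using hU
  choose x hx using hx
  choose y hy using hy
  have hu (n : ℕ) (j : J) : ∃ z : X j, ∀ s : S, ∀ h : (f s : J) = j,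
      z = h ▸ if n ∈ s.1 then x (f s) else y (f s) := by
    by_cases hj : ∃ s : S, (f s : J) = j
    · obtain ⟨s, rfl⟩ := hj
      refine ⟨if n ∈ s.1 then x (f s) else y (f s), fun t ht => ?_⟩
      obtain rfl := f.injective (Subtype.ext ht)
      rfl
    · exact ⟨Classical.arbitrary _, fun s hs => (hj ⟨s, hs⟩).elim⟩
  choose u hu using hu
  obtain ⟨a, φ, hφ, ha⟩ := SeqCompactSpace.exists_subseq_tendsto u
  obtain ⟨s, hs, hin, hout⟩ := hsplit (Set.range φ) (Set.infinite_range_of_injective hφ.injective)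
  let t : S := ⟨s, hs⟩
  have hu' (n : ℕ) : u n (f t) = if n ∈ s then x (f t) else y (f t) := hu n (f t) t rfl
  have hpre {B : Set ℕ} (hB : (Set.range φ ∩ B).Infinite) : ∃ᶠ n in atTop, φ n ∈ B := by
    rw [Nat.frequently_atTop_iff_infinite]
    refine Set.Infinite.of_image φ (hB.mono ?_)
    rintro _ ⟨⟨n, rfl⟩, hn⟩
    exact ⟨n, hn, rfl⟩
  refine not_tendsto_of_frequently_mem_disjoint (hC (f t)) (hD (f t)) (hCD (f t)) ?_ ?_ _
    (tendsto_pi_nhds.1 ha (f t))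
  · refine (hpre hin).mono fun n hn => ?_
    simpa [hu', hn] using hx (f t)
  · refine (hpre (B := sᶜ) hout).mono fun n hn => ?_
    have hn : φ n ∉ s := hn
    simpa [hu', hn] using hy (f t)

theorem seqCompactSpace_pi_of_mk_nonconvergent_lt {J : Type u} (X : J → Type*)
    [∀ j, TopologicalSpace (X j)] [∀ j, SeqCompactSpace (X j)]
    (hJ : Cardinal.mk {j : J | ∃ u : ℕ → X j, ∀ p : X j, ¬ Tendsto u atTop (𝓝 p)} <
      Cardinal.lift.{u} hCardinal) : SeqCompactSpace (Π j, X j) := by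
  set N := {j : J | ∃ u : ℕ → X j, ∀ p : X j, ¬ Tendsto u atTop (𝓝 p)}
  have := seqCompactSpace_pi_of_mk_lt_hCardinal (fun j : N => X j) hJ
  refine seqCompactSpace_of_forall_exists fun u => ?_
  obtain ⟨a, φ, hφ, ha⟩ := SeqCompactSpace.exists_subseq_tendsto fun n (j : N) => u n j
  have hlim (j : J) : ∃ p, Tendsto (fun n => u (φ n) j) atTop (𝓝 p) := by
    by_cases hj : j ∈ N
    · exact ⟨_, tendsto_pi_nhds.1 ha ⟨j, hj⟩⟩
    · by_contra! h
      exact hj ⟨_, h⟩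
  choose b hb using hlim
  exact ⟨b, φ, hφ, tendsto_pi_nhds.2 hb⟩

/-- Assuming `𝔥 = 𝔰`, a product of nonempty spaces is sequentially compact iff all
factors are sequentially compact and fewer than `𝔰` of them contain a nonconverging
sequence, iff all factors are sequentially compact and all but fewer than `𝔰` of them
are ultraconnected. -/
theorem seqCompact_pi_iff_of_h_eq_s (hhs : hCardinal = splittingNumber)
    {J : Type u} (X : J → Type u)
    [∀ j, TopologicalSpace (X j)] [∀ j, Nonempty (X j)] :
    (SeqCompactSpace (Π j, X j) ↔
      ((∀ j, SeqCompactSpace (X j)) ∧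
        Cardinal.mk {j : J | ∃ u : ℕ → X j, ∀ p : X j,
            ¬ Filter.Tendsto u Filter.atTop (nhds p)} <
          Cardinal.lift.{u} splittingNumber)) ∧
    (SeqCompactSpace (Π j, X j) ↔
      ((∀ j, SeqCompactSpace (X j)) ∧
        Cardinal.mk {j : J | ¬ Ultraconnected (X j)} <
          Cardinal.lift.{u} splittingNumber)) := by
  have hset (h : ∀ j, SeqCompactSpace (X j)) :
      {j : J | ∃ u : ℕ → X j, ∀ p : X j, ¬ Tendsto u atTop (𝓝 p)} =
        {j : J | ¬ Ultraconnected (X j)} := by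
    ext j
    simp [ultraconnected_iff_forall_exists_tendsto]
  have hult : SeqCompactSpace (Π j, X j) ↔ (∀ j, SeqCompactSpace (X j)) ∧
      Cardinal.mk {j : J | ¬ Ultraconnected (X j)} < Cardinal.lift.{u} splittingNumber := by
    refine ⟨fun _ => ⟨.of_pi, mk_not_ultraconnected_lt_splittingNumber X⟩, fun ⟨h, hlt⟩ => ?_⟩
    rw [← hset h, ← hhs] at hlt
    exact seqCompactSpace_pi_of_mk_nonconvergent_lt X hlt
  exact ⟨hult.trans (and_congr_right fun h => by rw [hset h]), hult⟩
end
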